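/- arXiv:1210.2544 — 9 statements merged into one kernel-verified Lean document; each statement's English description precedes it below -/
import Mathlib

section
/- A finite multigraph (V, m) has a full functional orientation if and only if every connected component S of (V, m) satisfies edgeCount(S) ≤ |S| (that is, every connected component is acyclic or unicyclic). -/
/-- The degree of a vertex in a finite multigraph given by its multiplicity
function `m : V → V → ℕ`. -/
def degree {V : Type*} [Fintype V] (m : V → V → ℕ) (v : V) : ℕ := ∑ u, m v u

/-- A full functional orientation of the multigraph `m`: every non-isolated
vertex `v` has its one out-edge `v → f v` along an actual edge, and every
parallel edge between distinct `u` and `v` receives a direction, the single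
out-edge of a vertex accounting for at most one of them. -/
def IsFullFO {V : Type*} [Fintype V] [DecidableEq V] (m : V → V → ℕ) (f : V → V) : Prop :=
  (∀ v, degree m v ≠ 0 → 0 < m v (f v)) ∧
  ∀ u v, u ≠ v → m u v ≤ (if f u = v then 1 else 0) + (if f v = u then 1 else 0)

open scoped Classical in
/-- The connected component of the vertex `w` in the multigraph `m`: the
equivalence class of `w` under the equivalence relation generated by
adjacency. -/
noncomputable def component {V : Type*} [Fintype V] (m : V → V → ℕ) (w : V) : Finset V :=
  Finset.univ.filter fun u => Relation.EqvGen (fun a b => 0 < m a b) w u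

/-- The number of edges of the multigraph `m` inside the vertex set `S`. -/
def edgeCount {V : Type*} (m : V → V → ℕ) (S : Finset V) : ℕ :=
  (∑ u ∈ S, ∑ v ∈ S, m u v) / 2

/-- The simple graph underlying a multigraph. -/
def underlyingGraph {V : Type*} (m : V → V → ℕ) : SimpleGraph V :=
  SimpleGraph.fromRel fun u v => 0 < m u v

/-- The multiplicity function of the multigraph in which every vertex other than `r` is joined by
one edge to its parent under `p`. -/
def parentMult {V : Type*} [DecidableEq V] (r : V) (p : V → V) (u v : V) : ℕ :=
  (if u ≠ r ∧ p u = v then 1 else 0) + (if v ≠ r ∧ p v = u then 1 else 0)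

/-- The multiplicity function of a single edge between `a` and `b`. -/
def edgeMult {V : Type*} [DecidableEq V] (a b u v : V) : ℕ :=
  (if u = a ∧ v = b then 1 else 0) + (if u = b ∧ v = a then 1 else 0)

lemma sum_edgeMult {V : Type*} [DecidableEq V] {S : Finset V} {a b : V} (ha : a ∈ S)
    (hb : b ∈ S) : ∑ u ∈ S, ∑ v ∈ S, edgeMult a b u v = 2 := by
  simp [edgeMult, Finset.sum_add_distrib, ite_and, ha, hb]

lemma sum_parentMult {V : Type*} [DecidableEq V] {S : Finset V} {r : V} {p : V → V}
    (hr : r ∈ S) (hp : ∀ v ∈ S, v ≠ r → p v ∈ S) :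
    ∑ u ∈ S, ∑ v ∈ S, parentMult r p u v + 2 = 2 * S.card := by
  have key : ∑ u ∈ S, ∑ v ∈ S, (if u ≠ r ∧ p u = v then 1 else 0) + 1 = S.card := by
    rw [← Finset.card_erase_add_one hr, Finset.card_eq_sum_ones,
      ← Finset.sum_erase_add _ _ hr]
    congr 1
    simp only [ne_eq, not_true_eq_false, false_and, if_false, Finset.sum_const_zero, add_zero]
    refine Finset.sum_congr rfl fun u hu => ?_
    have hu' := Finset.mem_erase.1 hu
    simp [hu'.1, hp u hu'.2 hu'.1]
  simp only [parentMult, Finset.sum_add_distrib]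
  rw [Finset.sum_comm (f := fun u v => if v ≠ r ∧ p v = u then 1 else 0)]
  omega

/-- Every vertex connected to `r` can be given a parent one step closer to `r`. -/
lemma exists_parent {V : Type*} {m : V → V → ℕ} (hsymm : ∀ u v, m u v = m v u) (r : V) :
    ∃ (p : V → V) (d : V → ℕ), ∀ v, (underlyingGraph m).Reachable v r → v ≠ r →
      0 < m v (p v) ∧ d (p v) < d v := by
  have key : ∀ v, ∃ w, (underlyingGraph m).Reachable v r → v ≠ r →
      0 < m v w ∧ (underlyingGraph m).dist w r < (underlyingGraph m).dist v r := by
    intro v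
    by_cases h : (underlyingGraph m).Reachable v r
    · obtain ⟨q, hq⟩ := h.exists_walk_length_eq_dist
      cases q with
      | nil => exact ⟨r, fun _ h => absurd rfl h⟩
      | @cons _ w _ hadj q' =>
        refine ⟨w, fun _ _ => ⟨?_, ?_⟩⟩
        · rcases ((SimpleGraph.fromRel_adj _ _ _).1 hadj).2 with h | h
          · exact h
          · rwa [hsymm]
        · rw [← hq, SimpleGraph.Walk.length_cons]
          exact Nat.lt_succ_of_le (SimpleGraph.dist_le q')
    · exact ⟨v, fun h' => absurd h' h⟩
  choose p hp using key
  exact ⟨p, fun v => (underlyingGraph m).dist v r, hp⟩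

lemma reachable_of_pos {V : Type*} {m : V → V → ℕ} {u v : V} (h : 0 < m u v) :
    (underlyingGraph m).Reachable u v := by
  by_cases huv : u = v
  · exact huv ▸ SimpleGraph.Reachable.refl u
  · exact SimpleGraph.Adj.reachable ((SimpleGraph.fromRel_adj _ _ _).2 ⟨huv, Or.inl h⟩)

lemma parentMult_le {V : Type*} [DecidableEq V] {m : V → V → ℕ}
    (hsymm : ∀ u v, m u v = m v u) {S : Finset V} {r : V} {p : V → V} {d : V → ℕ}
    (hp : ∀ v ∈ S, v ≠ r → 0 < m v (p v) ∧ d (p v) < d v) {u v : V} (hu : u ∈ S)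
    (hv : v ∈ S) : parentMult r p u v ≤ m u v := by
  unfold parentMult
  split_ifs with h₁ h₂ h₂
  · have a := (hp u hu h₁.1).2
    have b := (hp v hv h₂.1).2
    rw [h₁.2] at a
    rw [h₂.2] at b
    omega
  · have a := (hp u hu h₁.1).1
    rw [h₁.2] at a
    omega
  · have b := (hp v hv h₂.1).1
    rw [h₂.2, hsymm] at b
    omega
  · omega

lemma edgeMult_add_le {V : Type*} [DecidableEq V] {m t : V → V → ℕ}
    (hm : ∀ u v, m u v = m v u) (ht : ∀ u v, t u v = t v u) {a b : V} (hab : a ≠ b)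
    (hlt : t a b < m a b) {u v : V} (hle : t u v ≤ m u v) :
    t u v + edgeMult a b u v ≤ m u v := by
  unfold edgeMult
  split_ifs with h₁ h₂ h₂
  · exact absurd (h₁.1.symm.trans h₂.1) hab
  · rw [h₁.1, h₁.2]
    omega
  · rw [h₂.1, h₂.2, hm b a, ht b a]
    omega
  · omega

lemma parentMult_comm {V : Type*} [DecidableEq V] (r : V) (p : V → V) (u v : V) :
    parentMult r p u v = parentMult r p v u := add_comm _ _

lemma edgeMult_comm {V : Type*} [DecidableEq V] (a b u v : V) :
    edgeMult a b u v = edgeMult a b v u := by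
  simp only [edgeMult, and_comm, add_comm]

/-- A connected vertex set with fewer edges than vertices is spanned by its parent edges. -/
lemma exists_parent_of_sum_lt {V : Type*} [DecidableEq V] {m : V → V → ℕ}
    (hsymm : ∀ u v, m u v = m v u) (hloop : ∀ v, m v v = 0) {S : Finset V} {r : V}
    (hr : r ∈ S) (hclosed : ∀ u ∈ S, ∀ v, 0 < m u v → v ∈ S)
    (hconn : ∀ v ∈ S, (underlyingGraph m).Reachable v r)
    (hsum : ∑ u ∈ S, ∑ v ∈ S, m u v < 2 * S.card) :
    ∃ p : V → V, (∀ v ∈ S, v ≠ r → 0 < m v (p v)) ∧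
      ∀ u ∈ S, ∀ v ∈ S, m u v ≤ parentMult r p u v := by
  obtain ⟨p, d, hpd⟩ := exists_parent hsymm r
  have hp : ∀ v ∈ S, v ≠ r → 0 < m v (p v) ∧ d (p v) < d v :=
    fun v hv hne => hpd v (hconn v hv) hne
  refine ⟨p, fun v hv hne => (hp v hv hne).1, ?_⟩
  by_contra! hcon
  obtain ⟨a, ha, b, hb, hlt⟩ := hcon
  have hab : a ≠ b := by
    rintro rfl
    rw [hloop] at hlt
    omega
  have hcount := sum_parentMult hr fun v hv hne => hclosed v hv _ (hp v hv hne).1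
  have hle : ∑ u ∈ S, ∑ v ∈ S, (parentMult r p u v + edgeMult a b u v) ≤
      ∑ u ∈ S, ∑ v ∈ S, m u v :=
    Finset.sum_le_sum fun u hu => Finset.sum_le_sum fun v hv =>
      edgeMult_add_le hsymm (parentMult_comm r p) hab hlt (parentMult_le hsymm hp hu hv)
  simp only [Finset.sum_add_distrib, sum_edgeMult ha hb] at hle
  omega

/-- A connected vertex set with at most as many edges as vertices has a full functional
orientation. -/
lemma exists_orientation_of_connected {V : Type*} [Fintype V] [DecidableEq V] {m : V → V → ℕ}
    (hsymm : ∀ u v, m u v = m v u) (hloop : ∀ v, m v v = 0) {S : Finset V} {r : V}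
    (hr : r ∈ S) (hclosed : ∀ u ∈ S, ∀ v, 0 < m u v → v ∈ S)
    (hconn : ∀ v ∈ S, (underlyingGraph m).Reachable v r)
    (hsum : ∑ u ∈ S, ∑ v ∈ S, m u v < 2 * S.card + 2) :
    ∃ f : V → V, (∀ v ∈ S, degree m v ≠ 0 → 0 < m v (f v)) ∧
      ∀ u ∈ S, ∀ v ∈ S, m u v ≤ (if f u = v then 1 else 0) + (if f v = u then 1 else 0) := by
  obtain ⟨p, d, hpd⟩ := exists_parent hsymm r
  have hp : ∀ v ∈ S, v ≠ r → 0 < m v (p v) ∧ d (p v) < d v :=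
    fun v hv hne => hpd v (hconn v hv) hne
  by_cases hexc : ∃ a ∈ S, ∃ b ∈ S, parentMult r p a b < m a b
  · obtain ⟨a, ha, b, hb, hlt⟩ := hexc
    have hab : a ≠ b := by
      rintro rfl
      rw [hloop] at hlt
      omega
    have hadd : ∀ u ∈ S, ∀ v ∈ S, parentMult r p u v + edgeMult a b u v ≤ m u v :=
      fun u hu v hv =>
        edgeMult_add_le hsymm (parentMult_comm r p) hab hlt (parentMult_le hsymm hp hu hv)
    let m' : V → V → ℕ := fun u v => m u v - edgeMult a b u v
    have hsymm' : ∀ u v, m' u v = m' v u := fun u v => by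
      simp only [m', hsymm u v, edgeMult_comm a b u v]
    have hclosed' : ∀ u ∈ S, ∀ v, 0 < m' u v → v ∈ S := fun u hu v h =>
      hclosed u hu v (h.trans_le (Nat.sub_le _ _))
    have hroot : ∀ n, ∀ v ∈ S, d v = n → (underlyingGraph m').Reachable v r := by
      intro n
      induction n using Nat.strong_induction_on with
      | _ n ih =>
        intro v hv hn
        by_cases hvr : v = r
        · exact hvr ▸ SimpleGraph.Reachable.refl v
        · obtain ⟨hpos, hdlt⟩ := hp v hv hvr
          have hmem := hclosed v hv _ hpos
          refine (reachable_of_pos ?_).trans (ih _ (hn ▸ hdlt) (p v) hmem rfl)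
          have h₁ := hadd v hv (p v) hmem
          have h₂ : 1 ≤ parentMult r p v (p v) := by simp [parentMult, hvr]
          simp only [m']
          omega
    have hsum' : ∑ u ∈ S, ∑ v ∈ S, m' u v < 2 * S.card := by
      have heq : ∑ u ∈ S, ∑ v ∈ S, (m' u v + edgeMult a b u v) = ∑ u ∈ S, ∑ v ∈ S, m u v :=
        Finset.sum_congr rfl fun u hu => Finset.sum_congr rfl fun v hv =>
          Nat.sub_add_cancel (le_of_add_le_right (hadd u hu v hv))
      simp only [Finset.sum_add_distrib, sum_edgeMult ha hb] at heq
      omega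
    obtain ⟨q, hq, hcover⟩ := exists_parent_of_sum_lt hsymm'
      (fun v => by simp [m', hloop]) ha hclosed'
      (fun v hv => (hroot _ v hv rfl).trans (hroot _ a ha rfl).symm) hsum'
    refine ⟨Function.update q a b, fun v hv _ => ?_, fun u hu v hv => ?_⟩
    · by_cases hva : v = a
      · subst hva
        simpa using (Nat.zero_le _).trans_lt hlt
      · simpa [hva] using (hq v hv hva).trans_le (Nat.sub_le _ _)
    · have h₁ := hcover u hu v hv
      have h₂ : m u v ≤ parentMult a q u v + edgeMult a b u v := by
        simp only [m'] at h₁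
        omega
      refine h₂.trans ?_
      simp only [parentMult, edgeMult, Function.update_apply]
      grind
  · push Not at hexc
    obtain ⟨s, hs⟩ : ∃ s, degree m r ≠ 0 → 0 < m r s := by
      by_cases hdeg : degree m r = 0
      · exact ⟨r, fun h => absurd hdeg h⟩
      · obtain ⟨s, -, hs⟩ := Finset.exists_ne_zero_of_sum_ne_zero hdeg
        exact ⟨s, fun _ => Nat.pos_of_ne_zero hs⟩
    refine ⟨Function.update p r s, fun v hv hdeg => ?_, fun u hu v hv => ?_⟩
    · by_cases hvr : v = r
      · subst hvr
        simpa using hs hdeg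
      · simpa [hvr] using (hp v hv hvr).1
    · refine (hexc u hu v hv).trans ?_
      simp only [parentMult, Function.update_apply]
      grind

lemma mem_component {V : Type*} [Fintype V] {m : V → V → ℕ} {w u : V} :
    u ∈ component m w ↔ Relation.EqvGen (fun a b => 0 < m a b) w u := by
  simp [component]

lemma component_eq_of_pos {V : Type*} [Fintype V] {m : V → V → ℕ} {u v : V}
    (h : 0 < m u v) : component m u = component m v := by
  have huv : Relation.EqvGen (fun a b => 0 < m a b) u v := .rel _ _ h
  ext x
  rw [mem_component, mem_component]
  exact ⟨fun hx => (huv.symm _ _).trans _ _ _ hx, fun hx => huv.trans _ _ _ hx⟩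

lemma reachable_of_eqvGen {V : Type*} {m : V → V → ℕ} {u v : V}
    (h : Relation.EqvGen (fun a b => 0 < m a b) u v) : (underlyingGraph m).Reachable u v := by
  induction h with
  | rel _ _ h => exact reachable_of_pos h
  | refl _ => exact SimpleGraph.Reachable.refl _
  | symm _ _ _ ih => exact ih.symm
  | trans _ _ _ _ _ ih₁ ih₂ => exact ih₁.trans ih₂

lemma edgeCount_le_card_of_isFullFO {V : Type*} [Fintype V] [DecidableEq V] {m : V → V → ℕ}
    (hloop : ∀ v, m v v = 0) {f : V → V} (hf : IsFullFO m f) (S : Finset V) :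
    edgeCount m S ≤ S.card := by
  have hle : ∑ u ∈ S, ∑ v ∈ S, m u v ≤ ∑ u ∈ S, ∑ v ∈ S,
      ((if f u = v then 1 else 0) + (if f v = u then 1 else 0)) := by
    refine Finset.sum_le_sum fun u _ => Finset.sum_le_sum fun v _ => ?_
    by_cases huv : u = v
    · simp [huv, hloop]
    · exact hf.2 u v huv
  have hout : ∑ u ∈ S, ∑ v ∈ S, (if f u = v then 1 else 0) ≤ S.card := by
    rw [Finset.card_eq_sum_ones]
    refine Finset.sum_le_sum fun u _ => ?_
    rw [Finset.sum_ite_eq]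
    split_ifs <;> omega
  simp only [Finset.sum_add_distrib] at hle
  rw [Finset.sum_comm (f := fun u v => if f v = u then 1 else 0)] at hle
  unfold edgeCount
  omega

/-- A finite multigraph `(V, m)` has a full functional orientation if and only
if every connected component `S` satisfies `edgeCount S ≤ |S|`, i.e. every
connected component is acyclic or unicyclic. -/
theorem fullFO_iff_components_acyclic_or_unicyclic
    {V : Type*} [Fintype V] [DecidableEq V] (m : V → V → ℕ)
    (hsymm : ∀ u v, m u v = m v u) (hloop : ∀ v, m v v = 0) :
    (∃ f : V → V, IsFullFO m f) ↔
      ∀ w : V, edgeCount m (component m w) ≤ (component m w).card := by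
  refine ⟨fun ⟨f, hf⟩ w => edgeCount_le_card_of_isFullFO hloop hf _, fun h => ?_⟩
  have hself : ∀ w, w ∈ component m w := fun w => mem_component.2 (.refl w)
  have key : ∀ S : Finset V, ∃ f : V → V, (∃ w, S = component m w) →
      (∀ v ∈ S, degree m v ≠ 0 → 0 < m v (f v)) ∧
      ∀ u ∈ S, ∀ v ∈ S, m u v ≤ (if f u = v then 1 else 0) + (if f v = u then 1 else 0) := by
    intro S
    by_cases hS : ∃ w, S = component m w
    · obtain ⟨w, rfl⟩ := hS
      obtain ⟨f, hf⟩ := exists_orientation_of_connected hsymm hloop (hself w)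
        (fun u hu v huv => mem_component.2 ((mem_component.1 hu).trans _ _ _ (.rel _ _ huv)))
        (fun v hv => (reachable_of_eqvGen (mem_component.1 hv)).symm)
        (by have := h w; unfold edgeCount at this; omega)
      exact ⟨f, fun _ => hf⟩
    · exact ⟨id, fun h => absurd h hS⟩
  choose F hF using key
  refine ⟨fun v => F (component m v) v, fun v => (hF _ ⟨v, rfl⟩).1 v (hself v),
    fun u v _ => ?_⟩
  rcases Nat.eq_zero_or_pos (m u v) with h0 | hpos
  · simp [h0]
  · have heq := component_eq_of_pos hpos
    have hle := (hF _ ⟨v, rfl⟩).2 u (heq ▸ hself u) v (hself v)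
    simpa only [heq] using hle
end

section
/- A finite multigraph (V, m) is FO-2-colorable if and only if there exists a coloring c : V → Bool such that every monochromatic component S satisfies edgeCount(S) ≤ |S| (that is, every induced monochromatic component is acyclic or unicyclic). -/
/-- An FO-2-coloring of the multigraph `m`: a 2-coloring `c` together with a
function `f` such that the submultigraph induced by each color class has a
full functional orientation given by `f`. -/
def IsFO2Coloring {V : Type*} [DecidableEq V] (m : V → V → ℕ) (c : V → Bool) (f : V → V) :
    Prop :=
  (∀ v, (∃ u, 0 < m v u ∧ c u = c v) → 0 < m v (f v) ∧ c (f v) = c v) ∧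
  ∀ u v, u ≠ v → c u = c v →
    m u v ≤ (if f u = v then 1 else 0) + (if f v = u then 1 else 0)

/-- The multigraph `m` is FO-2-colorable if some FO-2-coloring exists. -/
def FO2Colorable {V : Type*} [DecidableEq V] (m : V → V → ℕ) : Prop :=
  ∃ (c : V → Bool) (f : V → V), IsFO2Coloring m c f

/-- The submultigraph of `m` induced by the coloring `c`: only edges between
same-colored vertices are kept. -/
def monoSub {V : Type*} (m : V → V → ℕ) (c : V → Bool) : V → V → ℕ :=
  fun u v => if c u = c v then m u v else 0

/-- A symmetric loopless multigraph can be oriented: `n u v` is the number of edges between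
`u` and `v` that point from `u` to `v`. -/
theorem exists_orientation {V : Type*} [Fintype V] (m : V → V → ℕ)
    (hsymm : ∀ u v, m u v = m v u) (hloop : ∀ v, m v v = 0) :
    ∃ n : V → V → ℕ, ∀ u v, m u v = n u v + n v u := by
  let e := Fintype.equivFin V
  refine ⟨fun u v => if e u < e v then m u v else 0, fun u v => ?_⟩
  rcases lt_trichotomy (e u) (e v) with h | h | h
  · simp [h, h.le]
  · obtain rfl := e.injective h
    simp [hloop]
  · simp [h, h.le, hsymm u v]

theorem edgeCount_eq_sum_orientation {V : Type*} {m n : V → V → ℕ}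
    (hn : ∀ u v, m u v = n u v + n v u) (S : Finset V) :
    edgeCount m S = ∑ u ∈ S, ∑ v ∈ S, n u v := by
  have h : ∑ u ∈ S, ∑ v ∈ S, m u v = 2 * ∑ u ∈ S, ∑ v ∈ S, n u v := by
    simp only [hn, Finset.sum_add_distrib]
    rw [Finset.sum_comm (f := fun u v => n v u)]
    ring
  rw [edgeCount, h, Nat.mul_div_cancel_left _ two_pos]

theorem edgeCount_lt_edgeCount_insert {V : Type*} [DecidableEq V] {m n : V → V → ℕ}
    (hn : ∀ u v, m u v = n u v + n v u) {T : Finset V} {x y : V} (hx : x ∉ T) (hy : y ∈ T)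
    (hxy : 0 < m x y) : edgeCount m T < edgeCount m (insert x T) := by
  rw [edgeCount_eq_sum_orientation hn, edgeCount_eq_sum_orientation hn, Finset.sum_insert hx]
  simp only [Finset.sum_insert hx, Finset.sum_add_distrib]
  have h₁ : n x y ≤ ∑ v ∈ T, n x v := Finset.single_le_sum (fun _ _ => Nat.zero_le _) hy
  have h₂ : n y x ≤ ∑ v ∈ T, n v x :=
    Finset.single_le_sum (f := fun v => n v x) (fun _ _ => Nat.zero_le _) hy
  have := hn x y
  omega

theorem edgeCount_union_of_no_edges {V : Type*} [DecidableEq V] {m n : V → V → ℕ}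
    (hn : ∀ u v, m u v = n u v + n v u) {A B : Finset V} (hAB : Disjoint A B)
    (h : ∀ a ∈ A, ∀ b ∈ B, m a b = 0) :
    edgeCount m (A ∪ B) = edgeCount m A + edgeCount m B := by
  simp only [edgeCount_eq_sum_orientation hn, Finset.sum_union hAB, Finset.sum_add_distrib]
  have h₁ : ∑ a ∈ A, ∑ b ∈ B, n a b = 0 :=
    Finset.sum_eq_zero fun a ha => Finset.sum_eq_zero fun b hb => by
      have := hn a b
      have := h a ha b hb
      omega
  have h₂ : ∑ b ∈ B, ∑ a ∈ A, n b a = 0 :=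
    Finset.sum_eq_zero fun b hb => Finset.sum_eq_zero fun a ha => by
      have := hn a b
      have := h a ha b hb
      omega
  omega

/-- If each component has at most as many edges as vertices, so does each vertex set that is
closed under adjacency. -/
theorem edgeCount_le_card_of_closed {V : Type*} [Fintype V] [DecidableEq V] {m n : V → V → ℕ}
    (hn : ∀ u v, m u v = n u v + n v u)
    (hcomp : ∀ w, edgeCount m (component m w) ≤ (component m w).card)
    (T : Finset V) (hT : ∀ a b, 0 < m a b → (a ∈ T ↔ b ∈ T)) :
    edgeCount m T ≤ T.card := by
  induction T using Finset.strongInduction with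
  | H T ih =>
    rcases T.eq_empty_or_nonempty with rfl | ⟨w, hw⟩
    · simp [edgeCount]
    · have hclosed : ∀ a b, 0 < m a b → (a ∈ component m w ↔ b ∈ component m w) := by
        intro a b hab
        simp only [component, Finset.mem_filter, Finset.mem_univ, true_and]
        exact ⟨fun h => h.trans _ _ _ (.rel _ _ hab),
          fun h => h.trans _ _ _ (.symm _ _ (.rel _ _ hab))⟩
      have hww : w ∈ component m w := by
        simpa [component] using Relation.EqvGen.refl w
      have hsub : component m w ⊆ T := by
        have key : ∀ a b, Relation.EqvGen (fun a b => 0 < m a b) a b → (a ∈ T ↔ b ∈ T) := by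
          intro a b h
          induction h with
          | rel a b h => exact hT a b h
          | refl a => rfl
          | symm a b _ ih => exact ih.symm
          | trans a b c _ _ ih₁ ih₂ => exact ih₁.trans ih₂
        intro u hu
        simp only [component, Finset.mem_filter, Finset.mem_univ, true_and] at hu
        exact (key w u hu).1 hw
      have hrest := ih (T \ component m w)
        (Finset.sdiff_ssubset hsub ⟨w, hww⟩)
        (fun a b hab => by simp only [Finset.mem_sdiff, hT a b hab, hclosed a b hab])
      have hunion := edgeCount_union_of_no_edges hn
        (Finset.disjoint_sdiff (s := component m w) (t := T)) (fun a ha b hb => by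
          by_contra hab
          exact (Finset.mem_sdiff.1 hb).2 ((hclosed a b (Nat.pos_of_ne_zero hab)).1 ha))
      have hcard := Finset.card_sdiff_add_card_eq_card hsub
      rw [Finset.union_sdiff_of_subset hsub] at hunion
      have := hcomp w
      omega

/-- If each component has at most as many edges as vertices, so does each vertex set. -/
theorem edgeCount_le_card_of_component {V : Type*} [Fintype V] [DecidableEq V]
    {m n : V → V → ℕ} (hn : ∀ u v, m u v = n u v + n v u)
    (hcomp : ∀ w, edgeCount m (component m w) ≤ (component m w).card) (T : Finset V) :
    edgeCount m T ≤ T.card := by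
  induction T using WellFoundedGT.induction with
  | ind T ih =>
    by_cases hT : ∃ x y, x ∉ T ∧ y ∈ T ∧ 0 < m x y
    · obtain ⟨x, y, hx, hy, hxy⟩ := hT
      have h₁ := ih (insert x T) (Finset.ssubset_insert hx)
      have h₂ := edgeCount_lt_edgeCount_insert hn hx hy hxy
      rw [Finset.card_insert_of_notMem hx] at h₁
      omega
    · push Not at hT
      have hback : ∀ a b, 0 < m a b → b ∈ T → a ∈ T := by
        intro a b hab hb
        by_contra ha
        exact absurd hab (hT a b ha hb).not_gt
      refine edgeCount_le_card_of_closed hn hcomp T fun a b hab => ⟨hback b a ?_, hback a b hab⟩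
      rw [hn] at hab ⊢
      omega

/-- By Hall's theorem, the edges can be injectively assigned to their endpoints as soon as every
vertex set spans at most as many edges as it has vertices. -/
theorem exists_injective_endpoint {V : Type*} [DecidableEq V] {m n : V → V → ℕ}
    (hn : ∀ u v, m u v = n u v + n v u) (h : ∀ T : Finset V, edgeCount m T ≤ T.card) :
    ∃ g : (Σ p : V × V, Fin (n p.1 p.2)) → V,
      Function.Injective g ∧ ∀ x, g x = x.1.1 ∨ g x = x.1.2 := by
  classical
  obtain ⟨g, hg, hg'⟩ := (Finset.all_card_le_biUnion_card_iff_exists_injective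
    (fun x : (Σ p : V × V, Fin (n p.1 p.2)) => ({x.1.1, x.1.2} : Finset V))).1 fun F => by
      set T := F.biUnion fun x => ({x.1.1, x.1.2} : Finset V)
      refine le_trans ?_ (h T)
      have hsub : F ⊆ (T ×ˢ T).sigma fun _ => Finset.univ := by
        intro x hx
        simp only [Finset.mem_sigma, Finset.mem_product, Finset.mem_univ, and_true]
        exact ⟨Finset.mem_biUnion.2 ⟨x, hx, by simp⟩, Finset.mem_biUnion.2 ⟨x, hx, by simp⟩⟩
      refine (Finset.card_le_card hsub).trans_eq ?_
      rw [edgeCount_eq_sum_orientation hn, Finset.card_sigma, Finset.sum_product]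
      simp
  exact ⟨g, hg, fun x => by simpa using hg' x⟩

/-- If every component has at most as many edges as vertices, the multigraph has a full functional
orientation. -/
theorem exists_functional_orientation {V : Type*} [Fintype V] [DecidableEq V] (m : V → V → ℕ)
    (hsymm : ∀ u v, m u v = m v u) (hloop : ∀ v, m v v = 0)
    (hcomp : ∀ w, edgeCount m (component m w) ≤ (component m w).card) :
    ∃ f : V → V, (∀ v, (∃ u, 0 < m v u) → 0 < m v (f v)) ∧
      ∀ u v, u ≠ v → m u v ≤ (if f u = v then 1 else 0) + (if f v = u then 1 else 0) := by
  obtain ⟨n, hn⟩ := exists_orientation m hsymm hloop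
  obtain ⟨g, hg, hend⟩ := exists_injective_endpoint hn (edgeCount_le_card_of_component hn hcomp)
  have hf : ∀ v, ∃ w, (∀ x, g x = v → (x.1.1 = v ∧ x.1.2 = w) ∨ (x.1.2 = v ∧ x.1.1 = w)) ∧
      ((∃ u, 0 < m v u) → 0 < m v w) := by
    intro v
    by_cases hv : ∃ x, g x = v
    · obtain ⟨x, rfl⟩ := hv
      have hpos : 0 < n x.1.1 x.1.2 := x.2.pos
      rcases hend x with h | h
      · refine ⟨x.1.2, fun y hy => ?_, fun _ => ?_⟩
        · obtain rfl := hg hy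
          exact .inl ⟨h.symm, rfl⟩
        · rw [h, hn]
          omega
      · refine ⟨x.1.1, fun y hy => ?_, fun _ => ?_⟩
        · obtain rfl := hg hy
          exact .inr ⟨h.symm, rfl⟩
        · rw [h, hn]
          omega
    · by_cases hu : ∃ u, 0 < m v u
      · exact ⟨hu.choose, fun x hx => absurd ⟨x, hx⟩ hv, fun _ => hu.choose_spec⟩
      · exact ⟨v, fun x hx => absurd ⟨x, hx⟩ hv, fun h => absurd h hu⟩
  choose f hfg hfpos using hf
  refine ⟨f, hfpos, fun u v huv => ?_⟩
  let k : Fin (n u v) ⊕ Fin (n v u) → V :=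
    Sum.elim (fun i => g ⟨(u, v), i⟩) (fun i => g ⟨(v, u), i⟩)
  have hk : Function.Injective k := by
    rintro (i | i) (j | j) hij
    · simpa using hg hij
    · exact absurd (congrArg (fun x => x.1.1) (hg hij)) huv
    · exact absurd (congrArg (fun x => x.1.2) (hg hij)) huv
    · simpa using hg hij
  have hmem : ∀ i, k i ∈
      (if f u = v then {u} else ∅) ∪ (if f v = u then {v} else (∅ : Finset V)) := by
    have aux : ∀ x : (Σ p : V × V, Fin (n p.1 p.2)), x.1 = (u, v) ∨ x.1 = (v, u) →
        g x ∈ (if f u = v then {u} else ∅) ∪ (if f v = u then {v} else (∅ : Finset V)) := by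
      intro x hx
      have := hfg (g x) x rfl
      grind
    rintro (i | i)
    · exact aux _ (.inl rfl)
    · exact aux _ (.inr rfl)
  have hcard := Finset.card_le_card_of_injOn (s := Finset.univ) k (fun i _ => hmem i) hk.injOn
  rw [Finset.card_univ, Fintype.card_sum, Fintype.card_fin, Fintype.card_fin, ← hn] at hcard
  refine (hcard.trans (Finset.card_union_le _ _)).trans_eq ?_
  split_ifs <;> rfl

/-- A finite multigraph `(V, m)` is FO-2-colorable if and only if there is a
2-coloring `c` such that every induced monochromatic component `S` satisfies
`edgeCount S ≤ |S|`, i.e. every induced monochromatic component is acyclic or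
unicyclic. -/
theorem fo2Colorable_iff_mono_components_acyclic_or_unicyclic
    {V : Type*} [Fintype V] [DecidableEq V] (m : V → V → ℕ)
    (hsymm : ∀ u v, m u v = m v u) (hloop : ∀ v, m v v = 0) :
    FO2Colorable m ↔
      ∃ c : V → Bool, ∀ w : V,
        edgeCount (monoSub m c) (component (monoSub m c) w) ≤
          (component (monoSub m c) w).card := by
  constructor
  · rintro ⟨c, f, -, hf⟩
    refine ⟨c, fun w => ?_⟩
    generalize component (monoSub m c) w = S
    have hle : ∀ u v, monoSub m c u v ≤
        (if f u = v then 1 else 0) + (if f v = u then 1 else 0) := by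
      intro u v
      by_cases huv : u = v
      · simp [monoSub, huv, hloop]
      · by_cases hc : c u = c v
        · simpa [monoSub, hc] using hf u v huv hc
        · simp [monoSub, hc]
    have hout : ∑ u ∈ S, ∑ v ∈ S, (if f u = v then 1 else 0) ≤ S.card := by
      rw [Finset.card_eq_sum_ones]
      refine Finset.sum_le_sum fun u _ => ?_
      rw [Finset.sum_ite_eq]
      split_ifs <;> simp
    have hsum := Finset.sum_le_sum fun u (_ : u ∈ S) =>
      Finset.sum_le_sum fun v (_ : v ∈ S) => hle u v
    simp only [Finset.sum_add_distrib] at hsum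
    rw [Finset.sum_comm (f := fun u v => if f v = u then 1 else 0)] at hsum
    rw [edgeCount]
    omega
  · rintro ⟨c, hc⟩
    obtain ⟨f, hpos, hf⟩ := exists_functional_orientation (monoSub m c)
      (fun u v => by simp only [monoSub, hsymm u v, eq_comm]) (fun v => by simp [monoSub, hloop]) hc
    refine ⟨c, f, fun v ⟨u, hu, hcu⟩ => ?_, fun u v huv hcuv => ?_⟩
    · have := hpos v ⟨u, by simpa [monoSub, hcu] using hu⟩
      by_cases h : c v = c (f v)
      · exact ⟨by simpa [monoSub, h] using this, h.symm⟩
      · simp [monoSub, h] at this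
    · simpa [monoSub, hcuv] using hf u v huv
end

section
/- Every finite multigraph (V, m) in which every vertex has degree at most 5 is FO-2-colorable. -/
/-- A 2-coloring minimizing the number of monochromatic edges gives every vertex at least as many
differently colored as same-colored neighbors, counted with multiplicity. -/
lemma exists_coloring_same_le_diff {V : Type*} [Fintype V] [DecidableEq V] (m : V → V → ℕ)
    (hsymm : ∀ u v, m u v = m v u) (hloop : ∀ v, m v v = 0) :
    ∃ c : V → Bool, ∀ v, (∑ u, if c u = c v then m v u else 0) ≤
      ∑ u, if c u = c v then 0 else m v u := by
  obtain ⟨c, hc⟩ := Finite.exists_min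
    (fun c : V → Bool => ∑ u, ∑ w, if c w = c u then m u w else 0)
  refine ⟨c, fun v => ?_⟩
  have split : ∀ d : V → Bool, (∑ u, ∑ w, if d w = d u then m u w else 0) =
      2 * (∑ w, if d w = d v then m v w else 0) +
        ∑ u ∈ Finset.univ.erase v, ∑ w ∈ Finset.univ.erase v,
          if d w = d u then m u w else 0 := by
    intro d
    rw [← Finset.add_sum_erase _ _ (Finset.mem_univ v), two_mul, add_assoc]
    congr 1
    have inner : ∀ u ∈ Finset.univ.erase v, (∑ w, if d w = d u then m u w else 0) =
        (if d u = d v then m v u else 0) +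
          ∑ w ∈ Finset.univ.erase v, if d w = d u then m u w else 0 := by
      intro u _
      rw [← Finset.add_sum_erase _ _ (Finset.mem_univ v), hsymm u v]
      simp only [eq_comm]
    rw [Finset.sum_congr rfl inner, Finset.sum_add_distrib]
    congr 1
    exact Finset.sum_erase _ (by simp [hloop])
  have hmin := hc (Function.update c v (!c v))
  simp only [split] at hmin
  have hrest : (∑ u ∈ Finset.univ.erase v, ∑ w ∈ Finset.univ.erase v,
      if Function.update c v (!c v) w = Function.update c v (!c v) u then m u w else 0) =
      ∑ u ∈ Finset.univ.erase v, ∑ w ∈ Finset.univ.erase v,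
        if c w = c u then m u w else 0 := by
    refine Finset.sum_congr rfl fun u hu => Finset.sum_congr rfl fun w hw => ?_
    rw [Function.update_of_ne (Finset.ne_of_mem_erase hu),
      Function.update_of_ne (Finset.ne_of_mem_erase hw)]
  have hflip : (∑ w, if Function.update c v (!c v) w = Function.update c v (!c v) v
      then m v w else 0) = ∑ w, if c w = c v then 0 else m v w := by
    refine Finset.sum_congr rfl fun w _ => ?_
    by_cases hw : w = v
    · subst hw; simp [hloop]
    · rw [Function.update_of_ne hw, Function.update_self]
      cases c w <;> cases c v <;> simp
  rw [hrest, hflip] at hmin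
  omega

/-- In a finite graph of maximum degree at most 2, one can assign to distinct edges distinct
endpoints. -/
lemma SimpleGraph.exists_injective_endpoint {V : Type*} [Fintype V] [DecidableEq V]
    (G : SimpleGraph V) [DecidableRel G.Adj] (hG : ∀ v, G.degree v ≤ 2) :
    ∃ g : G.edgeSet → V, Function.Injective g ∧ ∀ e : G.edgeSet, g e ∈ (e : Sym2 V) := by
  have hall := (Finset.all_card_le_biUnion_card_iff_exists_injective
    (fun e : G.edgeSet => (e : Sym2 V).toFinset)).1 ?_
  · simpa using hall
  intro F
  have h := Finset.card_mul_le_card_mul (s := F) (m := 2) (n := 2)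
    (t := F.biUnion fun e => (e : Sym2 V).toFinset) (fun (e : G.edgeSet) v => v ∈ (e : Sym2 V)) ?_ ?_
  · omega
  · intro e he
    rw [← Sym2.card_toFinset_of_not_isDiag _ (G.not_isDiag_of_mem_edgeSet e.2)]
    refine Finset.card_le_card fun v hv => ?_
    simp only [Finset.mem_bipartiteAbove, Finset.mem_biUnion]
    exact ⟨⟨e, he, hv⟩, by simpa using hv⟩
  · intro v _
    refine le_trans ?_ (hG v)
    rw [← G.card_incidenceFinset_eq_degree]
    refine Finset.card_le_card_of_injOn (fun e => (e : Sym2 V)) ?_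
      Subtype.val_injective.injOn
    intro e he
    have he := ((Finset.mem_bipartiteBelow _).1 (Finset.mem_coe.1 he)).2
    simpa [SimpleGraph.incidenceSet] using he

/-- In a finite graph of maximum degree at most 2, one can choose for every non-isolated vertex
a neighbor so that every edge is chosen by one of its ends. -/
lemma SimpleGraph.exists_functional_orientation {V : Type*} [Fintype V] [DecidableEq V]
    (G : SimpleGraph V) [DecidableRel G.Adj] (hG : ∀ v, G.degree v ≤ 2) :
    ∃ f : V → V, (∀ v, (∃ u, G.Adj v u) → G.Adj v (f v)) ∧
      ∀ u v, G.Adj u v → f u = v ∨ f v = u := by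
  obtain ⟨g, hinj, hmem⟩ := G.exists_injective_endpoint hG
  have key : ∀ v, ∃ w, ((∃ u, G.Adj v u) → G.Adj v w) ∧
      ∀ u (h : G.Adj v u), g ⟨s(v, u), h⟩ = v → w = u := by
    intro v
    by_cases h : ∃ u, ∃ h : G.Adj v u, g ⟨s(v, u), h⟩ = v
    · obtain ⟨u, hu, hgu⟩ := h
      refine ⟨u, fun _ => hu, fun w hw hgw => ?_⟩
      have := congrArg Subtype.val (hinj (hgu.trans hgw.symm))
      exact Sym2.congr_right.1 this
    · by_cases h' : ∃ u, G.Adj v u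
      · obtain ⟨u, hu⟩ := h'
        exact ⟨u, fun _ => hu, fun w hw hgw => (h ⟨w, hw, hgw⟩).elim⟩
      · exact ⟨v, fun hv => (h' hv).elim, fun w hw hgw => (h ⟨w, hw, hgw⟩).elim⟩
  choose f hf hfg using key
  refine ⟨f, hf, fun u v huv => ?_⟩
  have := hmem ⟨s(u, v), huv⟩
  rcases Sym2.mem_iff.1 this with h | h
  · exact Or.inl (hfg u v huv h)
  · refine Or.inr (hfg v u huv.symm ?_)
    exact (congrArg g (Subtype.ext Sym2.eq_swap)).trans h

/-- A 2-coloring in which every vertex has at most two same-colored neighbors, counted with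
multiplicity, extends to an FO-2-coloring. -/
lemma exists_isFO2Coloring_of_same_le_two {V : Type*} [Fintype V] [DecidableEq V]
    (m : V → V → ℕ) (hsymm : ∀ u v, m u v = m v u) (hloop : ∀ v, m v v = 0) (c : V → Bool)
    (hc : ∀ v, (∑ u, if c u = c v then m v u else 0) ≤ 2) :
    ∃ f : V → V, IsFO2Coloring m c f := by
  let G : SimpleGraph V :=
    { Adj := fun v u => 0 < m v u ∧ c u = c v
      symm := ⟨fun v u h => ⟨hsymm v u ▸ h.1, h.2.symm⟩⟩
      loopless := ⟨fun v h => by simp [hloop] at h⟩ }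
  have hdec : DecidableRel G.Adj := fun v u => inferInstanceAs (Decidable (0 < m v u ∧ c u = c v))
  have hG : ∀ v, G.degree v ≤ 2 := by
    intro v
    refine le_trans ?_ (hc v)
    rw [← G.card_neighborFinset_eq_degree, G.neighborFinset_eq_filter, Finset.card_filter]
    refine Finset.sum_le_sum fun u _ => ?_
    by_cases h : G.Adj v u
    · rw [if_pos h, if_pos h.2]
      exact h.1
    · simp [h]
  obtain ⟨f, hf, hcover⟩ := G.exists_functional_orientation hG
  have hpair : ∀ u v, c v = c u → f u ≠ v → 0 < m u v → m u v ≤ 1 := by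
    intro u v huv hne hpos
    have hfu := hf u ⟨v, hpos, huv⟩
    have h : (∑ w ∈ {f u, v}, if c w = c u then m u w else 0) ≤
        ∑ w, if c w = c u then m u w else 0 :=
      Finset.sum_le_sum_of_subset (Finset.subset_univ _)
    rw [Finset.sum_pair hne, if_pos hfu.2, if_pos huv] at h
    have := hfu.1
    have := hc u
    omega
  refine ⟨f, hf, fun u v _ huv => ?_⟩
  rcases Nat.eq_zero_or_pos (m u v) with h0 | hpos
  · omega
  have hle : m u v ≤ 2 := by
    refine le_trans ?_ (hc u)
    simpa [huv] using Finset.single_le_sum (f := fun w => if c w = c u then m u w else 0)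
      (fun _ _ => Nat.zero_le _) (Finset.mem_univ v)
  have hcov := hcover u v ⟨hpos, huv.symm⟩
  have h1 := hpair u v huv.symm
  have h2 := hpair v u huv
  rw [hsymm v u] at h2
  split_ifs <;> first | omega | simp_all

/-- Every finite multigraph of maximum degree at most 5 is FO-2-colorable. -/
theorem fo2Colorable_of_maxDegree_le_five
    {V : Type*} [Fintype V] [DecidableEq V] (m : V → V → ℕ)
    (hsymm : ∀ u v, m u v = m v u) (hloop : ∀ v, m v v = 0)
    (hdeg : ∀ v, ∑ u, m v u ≤ 5) :
    FO2Colorable m := by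
  obtain ⟨c, hc⟩ := exists_coloring_same_le_diff m hsymm hloop
  refine ⟨c, exists_isFO2Coloring_of_same_le_two m hsymm hloop c fun v => ?_⟩
  have hsum : (∑ u, if c u = c v then m v u else 0) + (∑ u, if c u = c v then 0 else m v u) =
      ∑ u, m v u := by
    rw [← Finset.sum_add_distrib]
    exact Finset.sum_congr rfl fun u _ => by split_ifs <;> simp
  have := hc v
  have := hdeg v
  omega
end

section
/- For every finite multigraph (V, m) in which every vertex has degree at most Δ, there exists a coloring c : V → Bool such that every vertex v has at most ⌊Δ/2⌋ same-colored neighbors counted with multiplicity, i.e., ∑_{u with c u = c v} m v u ≤ Δ/2 (natural number division). -/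
/-- The effect on a symmetric quadratic form with zero diagonal of changing one coordinate. -/
theorem sum_sum_mul_add_ite {V : Type*} [Fintype V] [DecidableEq V] (a : V → V → ℤ)
    (hsymm : ∀ u v, a u v = a v u) (hdiag : ∀ v, a v v = 0) (s : V → ℤ) (v : V) (t : ℤ) :
    ∑ u, ∑ w, a u w * ((s u + if u = v then t else 0) * (s w + if w = v then t else 0)) =
      ∑ u, ∑ w, a u w * (s u * s w) + 2 * t * ∑ u, a v u * s u := by
  simp only [mul_add, add_mul, Finset.sum_add_distrib, mul_ite, ite_mul, mul_zero, zero_mul,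
    Finset.sum_ite_eq', Finset.mem_univ, if_true]
  rw [Finset.sum_comm (f := fun u w => if u = v then a u w * (t * s w) else 0)]
  simp only [Finset.sum_ite_eq', Finset.mem_univ, if_true, hdiag, hsymm _ v, zero_mul,
    add_zero, Finset.mul_sum, add_assoc]
  rw [← Finset.sum_add_distrib]
  congr 1
  refine Finset.sum_congr rfl fun u _ => ?_
  ring

/-- For every finite multigraph `(V, m)` of maximum degree at most `Δ`, there
is a 2-coloring `c : V → Bool` so that every vertex has at most `⌊Δ/2⌋`
same-colored neighbors, counted with multiplicity. -/
theorem exists_two_coloring_defect_half_maxDegree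
    {V : Type*} [Fintype V] (m : V → V → ℕ)
    (hsymm : ∀ u v, m u v = m v u) (hloop : ∀ v, m v v = 0)
    (Δ : ℕ) (hdeg : ∀ v, ∑ u, m v u ≤ Δ) :
    ∃ c : V → Bool, ∀ v, ∑ u ∈ Finset.univ.filter (fun u => c u = c v), m v u ≤ Δ / 2 := by
  classical
  let σ : Bool → ℤ := fun b => if b then 1 else -1
  obtain ⟨c, hc⟩ := Finite.exists_min
    fun c : V → Bool => ∑ u, ∑ w, (m u w : ℤ) * (σ (c u) * σ (c w))
  refine ⟨c, fun v => ?_⟩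
  have hflip : ∀ u, σ (Function.update c v (!c v) u) =
      σ (c u) + if u = v then -2 * σ (c v) else 0 := by
    intro u
    by_cases h : u = v
    · subst h
      cases hu : c u <;> simp [σ]
    · simp [h]
  have hmin := hc (Function.update c v (!c v))
  simp only [hflip] at hmin
  rw [sum_sum_mul_add_ite (fun u w => (m u w : ℤ)) (fun u w => by rw [hsymm])
    (fun u => by rw [hloop, Nat.cast_zero]) (fun u => σ (c u))] at hmin
  have hspin : σ (c v) * ∑ u, (m v u : ℤ) * σ (c u) =
      2 * ∑ u with c u = c v, (m v u : ℤ) - ∑ u, (m v u : ℤ) := by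
    rw [Finset.sum_filter, Finset.mul_sum, Finset.mul_sum, ← Finset.sum_sub_distrib]
    refine Finset.sum_congr rfl fun u _ => ?_
    cases c u <;> cases c v <;> simp [σ] <;> ring
  have hle : 2 * ∑ u with c u = c v, (m v u : ℤ) ≤ ∑ u, (m v u : ℤ) := by
    linarith
  have hdv := hdeg v
  norm_cast at hle
  omega
end

section
/- For every finite multigraph (V, m) in which every vertex has degree at most Δ, and every k ≥ 1, there exists a coloring c : V → Fin k such that every vertex v has at most ⌊Δ/k⌋ same-colored neighbors counted with multiplicity, i.e., ∑_{u with c u = c v} m v u ≤ Δ/k (natural number division). -/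
open Finset in
/-- In a loopless symmetric multigraph, twice the number of monochromatic edges is the contribution
of the pairs avoiding `v` plus twice the number of same-colored neighbors of `v`. -/
theorem sum_monochromatic_eq_erase_add_two_mul {V κ : Type*} [Fintype V] [DecidableEq V]
    [DecidableEq κ] (m : V → V → ℕ) (hsymm : ∀ u v, m u v = m v u) (hloop : ∀ v, m v v = 0)
    (c : V → κ) (v : V) :
    ∑ a, ∑ b, (if c b = c a then m a b else 0) =
      ∑ a ∈ univ.erase v, ∑ b ∈ univ.erase v, (if c b = c a then m a b else 0) +
        2 * ∑ b ∈ univ.erase v, (if c b = c v then m v b else 0) := by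
  have hrow (a : V) : ∑ b, (if c b = c a then m a b else 0) =
      ∑ b ∈ univ.erase v, (if c b = c a then m a b else 0) + if c v = c a then m a v else 0 :=
    (sum_erase_add univ _ (mem_univ v)).symm
  have hcol : ∑ a ∈ univ.erase v, (if c v = c a then m a v else 0) =
      ∑ b ∈ univ.erase v, (if c b = c v then m v b else 0) :=
    sum_congr rfl fun a _ => by rw [hsymm a v]; simp only [eq_comm]
  rw [← sum_erase_add univ _ (mem_univ v), sum_congr rfl fun a _ => hrow a, sum_add_distrib,
    hcol, hrow v, hloop]
  simp only [ite_self]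
  ring

open Finset in
/-- Some coloring with finitely many colors gives each vertex at most as many neighbors in its own
color class as in any other one. -/
theorem exists_coloring_sum_same_color_le {V κ : Type*} [Fintype V] [Finite κ] [Nonempty κ]
    [DecidableEq κ] (m : V → V → ℕ) (hsymm : ∀ u v, m u v = m v u) (hloop : ∀ v, m v v = 0) :
    ∃ c : V → κ, ∀ v i, ∑ u with c u = c v, m v u ≤ ∑ u with c u = i, m v u := by
  classical
  obtain ⟨c, hc⟩ := Finite.exists_min
    (fun c : V → κ => ∑ a, ∑ b, (if c b = c a then m a b else 0))
  refine ⟨c, fun v i => ?_⟩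
  have hmin := hc (Function.update c v i)
  have hrest : ∑ a ∈ univ.erase v, ∑ b ∈ univ.erase v,
      (if Function.update c v i b = Function.update c v i a then m a b else 0) =
      ∑ a ∈ univ.erase v, ∑ b ∈ univ.erase v, (if c b = c a then m a b else 0) :=
    sum_congr rfl fun a ha => sum_congr rfl fun b hb => by
      rw [Function.update_of_ne (ne_of_mem_erase ha), Function.update_of_ne (ne_of_mem_erase hb)]
  have hnew : ∑ b ∈ univ.erase v,
      (if Function.update c v i b = Function.update c v i v then m v b else 0) =
      ∑ b ∈ univ.erase v, (if c b = i then m v b else 0) :=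
    sum_congr rfl fun b hb => by
      rw [Function.update_of_ne (ne_of_mem_erase hb), Function.update_self]
  rw [sum_monochromatic_eq_erase_add_two_mul m hsymm hloop c v,
    sum_monochromatic_eq_erase_add_two_mul m hsymm hloop (Function.update c v i) v,
    hrest, hnew] at hmin
  have herase (j : κ) : ∑ b ∈ univ.erase v, (if c b = j then m v b else 0) =
      ∑ u with c u = j, m v u := by
    rw [sum_filter]
    exact sum_erase _ (by simp [hloop])
  rw [herase, herase] at hmin
  omega

/-- Lovász's decomposition result: for every finite multigraph `(V, m)` of
maximum degree at most `Δ` and every `k ≥ 1`, there is a `k`-coloring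
`c : V → Fin k` so that every vertex has at most `⌊Δ/k⌋` same-colored
neighbors, counted with multiplicity. -/
theorem exists_k_coloring_defect_maxDegree_div_k
    {V : Type*} [Fintype V] (m : V → V → ℕ)
    (hsymm : ∀ u v, m u v = m v u) (hloop : ∀ v, m v v = 0)
    (Δ k : ℕ) (hk : 1 ≤ k) (hdeg : ∀ v, ∑ u, m v u ≤ Δ) :
    ∃ c : V → Fin k, ∀ v, ∑ u ∈ Finset.univ.filter (fun u => c u = c v), m v u ≤ Δ / k := by
  have : NeZero k := ⟨by omega⟩
  obtain ⟨c, hc⟩ := exists_coloring_sum_same_color_le (κ := Fin k) m hsymm hloop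
  refine ⟨c, fun v => (Nat.le_div_iff_mul_le hk).2 ?_⟩
  calc (∑ u with c u = c v, m v u) * k
      = ∑ _i : Fin k, ∑ u with c u = c v, m v u := by simp [mul_comm]
    _ ≤ ∑ i : Fin k, ∑ u with c u = i, m v u := Finset.sum_le_sum fun i _ => hc v i
    _ = ∑ u, m v u := Finset.sum_fiberwise _ _ _
    _ ≤ Δ := hdeg v
end

section
/- Every finite multigraph (V, m) in which every vertex has degree at most 2 has a full functional orientation. -/
/-- The edges of the multigraph `m`, as triples `(u, v, k)` with `k < m u v`, each listed once by
requiring its first endpoint to have the smaller rank under `r`. -/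
abbrev Edge {V : Type*} (m : V → V → ℕ) (r : V → ℕ) : Type _ :=
  {x : V × V × ℕ // r x.1 < r x.2.1 ∧ x.2.2 < m x.1 x.2.1}

/-- The number of edges of a finite set incident with `v` is at most the degree of `v`. -/
lemma card_incident_le_degree {V : Type*} [Fintype V] [DecidableEq V] (m : V → V → ℕ)
    (hsymm : ∀ u v, m u v = m v u) (r : V → ℕ) (s : Finset (Edge m r)) (v : V) :
    (s.filter fun e => v = e.1.1 ∨ v = e.1.2.1).card ≤ degree m v := by
  have hcard : (Finset.univ.sigma fun u => Finset.range (m v u)).card = degree m v := by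
    simp [degree]
  rw [← hcard]
  refine Finset.card_le_card_of_injOn
    (fun e => ⟨if v = e.1.1 then e.1.2.1 else e.1.1, e.1.2.2⟩) ?_ ?_
  · rintro ⟨⟨a, b, k⟩, hr, hk⟩ he
    simp only [Finset.coe_filter, Set.mem_ofPred_eq] at he
    simp only [Finset.coe_sigma, Set.mem_sigma_iff, Finset.coe_univ, Set.mem_univ, true_and,
      Finset.coe_range, Set.mem_Iio]
    dsimp only at hr hk
    split_ifs with h
    · rwa [h]
    · obtain rfl := he.2.resolve_left h
      rwa [hsymm]
  · rintro ⟨⟨a, b, k⟩, hr, hk⟩ he ⟨⟨a', b', k'⟩, hr', hk'⟩ he' heq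
    simp only [Finset.coe_filter, Set.mem_ofPred_eq] at he he'
    simp only [Sigma.mk.injEq, heq_eq_eq] at heq
    simp only [Subtype.mk.injEq, Prod.mk.injEq]
    dsimp only at hr hr'
    grind

/-- In a multigraph of maximum degree at most 2, the edges can be assigned distinct endpoints. -/
lemma exists_injective_endpoint_s6 {V : Type*} [Fintype V] [DecidableEq V] (m : V → V → ℕ)
    (hsymm : ∀ u v, m u v = m v u) (hdeg : ∀ v, degree m v ≤ 2) (r : V → ℕ) :
    ∃ g : Edge m r → V, Function.Injective g ∧ ∀ e, g e = e.1.1 ∨ g e = e.1.2.1 := by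
  have hall := (Finset.all_card_le_biUnion_card_iff_exists_injective
    (fun e : Edge m r => ({e.1.1, e.1.2.1} : Finset V))).1 fun s => by
      refine Nat.le_of_mul_le_mul_right (c := 2) ?_ two_pos
      refine Finset.card_mul_le_card_mul (fun (e : Edge m r) v => v = e.1.1 ∨ v = e.1.2.1) ?_
        fun v _ => (card_incident_le_degree m hsymm r s v).trans (hdeg v)
      intro e he
      have hne : e.1.1 ≠ e.1.2.1 := fun h => e.2.1.ne (congrArg r h)
      rw [← Finset.card_pair hne]
      refine Finset.card_le_card fun v hv => ?_
      exact Finset.mem_filter.2 ⟨Finset.mem_biUnion.2 ⟨e, he, hv⟩, by simpa using hv⟩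
  simpa using hall

/-- Every finite multigraph of maximum degree at most 2 has a full functional
orientation. -/
theorem exists_fullFO_of_maxDegree_le_two
    {V : Type*} [Fintype V] [DecidableEq V] (m : V → V → ℕ)
    (hsymm : ∀ u v, m u v = m v u) (hloop : ∀ v, m v v = 0)
    (hdeg : ∀ v, degree m v ≤ 2) :
    ∃ f : V → V, IsFullFO m f := by
  obtain ⟨r, hr⟩ : ∃ r : V → ℕ, Function.Injective r :=
    ⟨fun v => Fintype.equivFin V v, Fin.val_injective.comp (Fintype.equivFin V).injective⟩
  obtain ⟨g, hg, hge⟩ := exists_injective_endpoint_s6 m hsymm hdeg r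
  have hout : ∀ v, ∃ w, (degree m v ≠ 0 → 0 < m v w) ∧
      ∀ e, g e = v → w = if v = e.1.1 then e.1.2.1 else e.1.1 := by
    intro v
    by_cases h : ∃ e, g e = v
    · obtain ⟨e, rfl⟩ := h
      refine ⟨_, fun _ => ?_, fun e' he' => by rw [hg he']⟩
      have hpos := Nat.zero_lt_of_lt e.2.2
      split_ifs with h
      · rwa [h]
      · rwa [(hge e).resolve_left h, hsymm]
    · by_cases hd : degree m v = 0
      · exact ⟨v, fun h' => absurd hd h', fun e he => absurd ⟨e, he⟩ h⟩
      · obtain ⟨w, -, hw⟩ := Finset.exists_ne_zero_of_sum_ne_zero hd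
        exact ⟨w, fun _ => Nat.pos_of_ne_zero hw, fun e he => absurd ⟨e, he⟩ h⟩
  choose f hpos hf using hout
  refine ⟨f, hpos, ?_⟩
  have key : ∀ u v, r u < r v →
      m u v ≤ (if f u = v then 1 else 0) + (if f v = u then 1 else 0) := by
    intro u v huv
    have hne : v ≠ u := fun h => huv.ne (congrArg r h.symm)
    have hle : m u v ≤ 2 :=
      (Finset.single_le_sum (f := m u) (fun _ _ => Nat.zero_le _) (Finset.mem_univ v)).trans
        (hdeg u)
    have hend : ∀ k (hk : k < m u v), (g ⟨(u, v, k), huv, hk⟩ = u ∧ f u = v) ∨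
        (g ⟨(u, v, k), huv, hk⟩ = v ∧ f v = u) := by
      intro k hk
      refine (hge ⟨(u, v, k), huv, hk⟩).imp (fun h => ⟨h, ?_⟩) fun h => ⟨h, ?_⟩
      · simpa using hf u _ h
      · simpa [hne] using hf v _ h
    have hdist : ∀ (h0 : 0 < m u v) (h1 : 1 < m u v),
        g ⟨(u, v, 0), huv, h0⟩ ≠ g ⟨(u, v, 1), huv, h1⟩ := fun _ _ h => by
      simpa using hg h
    by_cases h1 : 1 < m u v
    · have h0 : 0 < m u v := by omega
      have hd := hdist h0 h1
      have e0 := hend 0 h0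
      have e1 := hend 1 h1
      grind
    · by_cases h0 : 0 < m u v
      · have e0 := hend 0 h0
        grind
      · omega
  intro u v huv
  rcases lt_or_gt_of_ne (hr.ne huv) with h | h
  · exact key u v h
  · rw [hsymm, add_comm]
    exact key v u h
end

section
/- Let (V, m) be a finite multigraph containing an EQ-gadget with external vertices x, y and internal vertices γ, α, β, a, b, p, q. Then every FO-2-coloring (c, f) of (V, m) satisfies c x = c y and c γ ≠ c x. -/
/-- The multiplicity matrix of the EQ-gadget on nine vertices, listed in the
order `x, y, γ, α, β, a, b, p, q` (indices `0, …, 8`):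
`m x γ = m y γ = 2`, `m γ α = m γ β = m α β = 1`, `m α a = m α b = 2`,
`m a b = 3`, `m β p = m β q = 2`, `m p q = 3`, and `0` elsewhere. -/
def eqM : Fin 9 → Fin 9 → ℕ :=
  ![![0,0,2,0,0,0,0,0,0],
    ![0,0,2,0,0,0,0,0,0],
    ![2,2,0,1,1,0,0,0,0],
    ![0,0,1,0,1,2,2,0,0],
    ![0,0,1,1,0,0,0,2,2],
    ![0,0,0,2,0,0,3,0,0],
    ![0,0,0,2,0,3,0,0,0],
    ![0,0,0,0,2,0,0,0,3],
    ![0,0,0,0,2,0,0,3,0]]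

/-- `e` embeds an EQ-gadget into the multigraph `m`: the nine vertices
`e 0, …, e 8` are distinct, `m` takes exactly the EQ-gadget values on them,
and each of the seven internal vertices (indices `2, …, 8`) has `m`-value `0`
to every vertex outside the nine. The external vertices are `e 0` and `e 1`. -/
def IsEQEmbedding {V : Type*} (m : V → V → ℕ) (e : Fin 9 → V) : Prop :=
  Function.Injective e ∧
  (∀ i j, m (e i) (e j) = eqM i j) ∧
  (∀ i : Fin 9, 2 ≤ (i : ℕ) → ∀ v, (∀ j, v ≠ e j) → m (e i) v = 0)

namespace IsFO2Coloring

variable {V : Type*} [DecidableEq V] {m : V → V → ℕ} {c : V → Bool} {f : V → V} {u v w : V}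

theorem color_ne_of_three (h : IsFO2Coloring m c f) (huv : u ≠ v) (hm : m u v = 3) :
    c u ≠ c v := by
  intro hc
  have := h.2 u v huv hc
  split_ifs at this <;> omega

theorem map_eq_of_two (h : IsFO2Coloring m c f) (huv : u ≠ v) (hm : m u v = 2)
    (hc : c u = c v) : f u = v := by
  have := h.2 u v huv hc
  by_contra hf
  rw [if_neg hf] at this
  split_ifs at this <;> omega

theorem map_eq_or_of_one (h : IsFO2Coloring m c f) (huv : u ≠ v) (hm : m u v = 1)
    (hc : c u = c v) : f u = v ∨ f v = u := by
  have := h.2 u v huv hc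
  by_contra! hf
  rw [if_neg hf.1, if_neg hf.2] at this
  omega

/-- Two vertices joined by a triple edge capture `f` at a vertex doubly joined to both. -/
theorem map_eq_or_of_two_two_three (h : IsFO2Coloring m c f) (huv : u ≠ v) (huw : u ≠ w)
    (hvw : v ≠ w) (muv : m u v = 2) (muw : m u w = 2) (mvw : m v w = 3) :
    f u = v ∨ f u = w := by
  by_cases hc : c u = c v
  · exact .inl (h.map_eq_of_two huv muv hc)
  · refine .inr (h.map_eq_of_two huw muw ?_)
    have := h.color_ne_of_three hvw mvw
    cases hu : c u <;> cases hv : c v <;> cases hw : c w <;> simp_all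

end IsFO2Coloring

/-- The EQ-gadget: if a finite multigraph contains an EQ-gadget with external
vertices `x, y` and internal vertices `γ, α, β, a, b, p, q`, then every
FO-2-coloring colors `x` and `y` alike and `γ` oppositely to `x`. -/
theorem eq_gadget
    {V : Type*} [Fintype V] [DecidableEq V] (m : V → V → ℕ)
    (hsymm : ∀ u v, m u v = m v u) (hloop : ∀ v, m v v = 0)
    (x y γ α β a b p q : V)
    (hgadget : IsEQEmbedding m ![x, y, γ, α, β, a, b, p, q])
    (c : V → Bool) (f : V → V) (hcf : IsFO2Coloring m c f) :
    c x = c y ∧ c γ ≠ c x := by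
  obtain ⟨hinj, hm, -⟩ := hgadget
  have hne : ∀ i j : Fin 9, i ≠ j →
      ![x, y, γ, α, β, a, b, p, q] i ≠ ![x, y, γ, α, β, a, b, p, q] j :=
    fun i j hij h => hij (hinj h)
  have hαf : f α = a ∨ f α = b :=
    hcf.map_eq_or_of_two_two_three (hne 3 5 (by decide)) (hne 3 6 (by decide))
      (hne 5 6 (by decide)) (hm 3 5) (hm 3 6) (hm 5 6)
  have hβf : f β = p ∨ f β = q :=
    hcf.map_eq_or_of_two_two_three (hne 4 7 (by decide)) (hne 4 8 (by decide))
      (hne 7 8 (by decide)) (hm 4 7) (hm 4 8) (hm 7 8)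
  have hαβ : f α ≠ β := by
    rcases hαf with h | h <;> rw [h]
    exacts [hne 5 4 (by decide), hne 6 4 (by decide)]
  have hαγ : f α ≠ γ := by
    rcases hαf with h | h <;> rw [h]
    exacts [hne 5 2 (by decide), hne 6 2 (by decide)]
  have hβα : f β ≠ α := by
    rcases hβf with h | h <;> rw [h]
    exacts [hne 7 3 (by decide), hne 8 3 (by decide)]
  have hβγ : f β ≠ γ := by
    rcases hβf with h | h <;> rw [h]
    exacts [hne 7 2 (by decide), hne 8 2 (by decide)]
  have hc : c α ≠ c β := fun h =>
    (hcf.map_eq_or_of_one (hne 3 4 (by decide)) (hm 3 4) h).elim hαβ hβα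
  have hγf : f γ = α ∨ f γ = β := by
    by_cases h : c γ = c α
    · exact .inl ((hcf.map_eq_or_of_one (hne 2 3 (by decide)) (hm 2 3) h).resolve_right hαγ)
    · have h' : c γ = c β := by
        cases hγ : c γ <;> cases hα : c α <;> cases hβ : c β <;> simp_all
      exact .inr ((hcf.map_eq_or_of_one (hne 2 4 (by decide)) (hm 2 4) h').resolve_right hβγ)
  have hx : c γ ≠ c x := fun h => by
    have hfx : f γ = x := hcf.map_eq_of_two (hne 2 0 (by decide)) (hm 2 0) h
    rw [hfx] at hγf
    exact hγf.elim (hne 0 3 (by decide)) (hne 0 4 (by decide))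
  have hy : c γ ≠ c y := fun h => by
    have hfy : f γ = y := hcf.map_eq_of_two (hne 2 1 (by decide)) (hm 2 1) h
    rw [hfy] at hγf
    exact hγf.elim (hne 1 3 (by decide)) (hne 1 4 (by decide))
  refine ⟨?_, hx⟩
  cases hγ : c γ <;> cases hcx : c x <;> cases hcy : c y <;> simp_all
end

section
/- Let (V, m) be a finite multigraph containing an NE-gadget with external vertices x, y. Then every FO-2-coloring (c, f) of (V, m) satisfies c x ≠ c y. -/
/-- The multigraph `m` contains an EQ-gadget with external vertices `x, y` and
set of internal vertices `S`. -/
def IsEQGadget {V : Type*} (m : V → V → ℕ) (x y : V) (S : Set V) : Prop :=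
  ∃ e : Fin 9 → V, IsEQEmbedding m e ∧ e 0 = x ∧ e 1 = y ∧
    S = {w | ∃ i : Fin 9, 2 ≤ (i : ℕ) ∧ e i = w}

/-- The multigraph `m` contains an NE-gadget with external vertices `x, y` and
set of internal vertices `S`: there are vertices `u, v` joined by a triple
edge, EQ-gadgets with external pairs `(x, u)` and `(y, v)` whose internal
vertices together with `x, y, u, v` are pairwise distinct, and `u` and `v`
have `m`-value `0` to every vertex other than each other and the vertices of
their respective EQ-gadgets. -/
def IsNEGadget {V : Type*} (m : V → V → ℕ) (x y : V) (S : Set V) : Prop :=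
  ∃ (u v : V) (S₁ S₂ : Set V),
    m u v = 3 ∧
    IsEQGadget m x u S₁ ∧ IsEQGadget m y v S₂ ∧
    List.Pairwise (· ≠ ·) [x, y, u, v] ∧
    Disjoint S₁ S₂ ∧ Disjoint ({x, y, u, v} : Set V) (S₁ ∪ S₂) ∧
    (∀ w, w ∉ S₁ → w ∉ ({x, u, v} : Set V) → m u w = 0) ∧
    (∀ w, w ∉ S₂ → w ∉ ({y, v, u} : Set V) → m v w = 0) ∧
    S = S₁ ∪ S₂ ∪ {u, v}

namespace IsFO2Coloring

variable {V : Type*} [DecidableEq V] {m : V → V → ℕ} {c : V → Bool} {f : V → V}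

theorem ne_of_three_le (h : IsFO2Coloring m c f) {u v : V} (huv : u ≠ v) (hm : 3 ≤ m u v) :
    c u ≠ c v := by
  intro hc
  have := h.2 u v huv hc
  split_ifs at this <;> omega

theorem apply_eq_of_two_le (h : IsFO2Coloring m c f) {u v : V} (huv : u ≠ v)
    (hm : 2 ≤ m u v) (hc : c u = c v) : f u = v := by
  have := h.2 u v huv hc
  split_ifs at this <;> first | assumption | omega

theorem apply_eq_or_of_one_le (h : IsFO2Coloring m c f) {u v : V} (huv : u ≠ v)
    (hm : 1 ≤ m u v) (hc : c u = c v) : f u = v ∨ f v = u := by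
  have := h.2 u v huv hc
  split_ifs at this <;> first | tauto | omega

/-- A vertex joined by double edges to both ends of a triple edge is mapped to one of these
ends. -/
theorem apply_eq_or_of_triangle (h : IsFO2Coloring m c f) {w a b : V} (hwa : w ≠ a)
    (hwb : w ≠ b) (hab : a ≠ b) (hma : 2 ≤ m w a) (hmb : 2 ≤ m w b) (hmab : 3 ≤ m a b) :
    f w = a ∨ f w = b := by
  have hne := h.ne_of_three_le hab hmab
  by_cases hc : c w = c a
  · exact .inl (h.apply_eq_of_two_le hwa hma hc)
  · exact .inr (h.apply_eq_of_two_le hwb hmb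
      ((Bool.eq_not.2 hc).trans (Bool.eq_not.2 hne.symm).symm))

/-- The external vertices of an EQ-gadget receive the same color. -/
theorem eq_of_isEQGadget (h : IsFO2Coloring m c f) {x y : V} {S : Set V}
    (hg : IsEQGadget m x y S) : c x = c y := by
  obtain ⟨e, ⟨hinj, hm, -⟩, rfl, rfl, -⟩ := hg
  have hne {i j : Fin 9} (hij : i ≠ j) : e i ≠ e j := hinj.ne hij
  have hα : f (e 3) = e 5 ∨ f (e 3) = e 6 :=
    h.apply_eq_or_of_triangle (hne (by decide)) (hne (by decide)) (hne (by decide))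
      (by rw [hm]; decide) (by rw [hm]; decide) (by rw [hm]; decide)
  have hβ : f (e 4) = e 7 ∨ f (e 4) = e 8 :=
    h.apply_eq_or_of_triangle (hne (by decide)) (hne (by decide)) (hne (by decide))
      (by rw [hm]; decide) (by rw [hm]; decide) (by rw [hm]; decide)
  have hα' {i : Fin 9} (h₅ : 5 ≠ i) (h₆ : 6 ≠ i) : f (e 3) ≠ e i := by
    rcases hα with hα | hα <;> rw [hα] <;> exact hne ‹_›
  have hβ' {i : Fin 9} (h₇ : 7 ≠ i) (h₈ : 8 ≠ i) : f (e 4) ≠ e i := by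
    rcases hβ with hβ | hβ <;> rw [hβ] <;> exact hne ‹_›
  have hαβ : c (e 3) ≠ c (e 4) := fun hc ↦
    (h.apply_eq_or_of_one_le (hne (by decide)) (by rw [hm]; decide) hc).elim
      (hα' (by decide) (by decide)) (hβ' (by decide) (by decide))
  have hγ : f (e 2) = e 3 ∨ f (e 2) = e 4 := by
    by_cases hc : c (e 2) = c (e 3)
    · exact .inl <| (h.apply_eq_or_of_one_le (hne (by decide)) (by rw [hm]; decide)
        hc).resolve_right (hα' (by decide) (by decide))
    · exact .inr <| (h.apply_eq_or_of_one_le (hne (by decide)) (by rw [hm]; decide)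
        ((Bool.eq_not.2 hc).trans (Bool.eq_not.2 hαβ.symm).symm)).resolve_right
          (hβ' (by decide) (by decide))
  have hγ' {i : Fin 9} (h₂ : 2 ≠ i) (h₃ : 3 ≠ i) (h₄ : 4 ≠ i) (hi : 2 ≤ eqM 2 i) :
      c (e 2) ≠ c (e i) := by
    intro hc
    have hf := h.apply_eq_of_two_le (hne h₂) (by rwa [hm]) hc
    rcases hγ with hγ | hγ
    · exact hne h₃ (hγ.symm.trans hf)
    · exact hne h₄ (hγ.symm.trans hf)
  have h₀ := hγ' (i := 0) (by decide) (by decide) (by decide) (by decide)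
  have h₁ := hγ' (i := 1) (by decide) (by decide) (by decide) (by decide)
  exact (Bool.eq_not.2 h₀.symm).trans (Bool.eq_not.2 h₁.symm).symm

end IsFO2Coloring

/-- The NE-gadget: if a finite multigraph contains an NE-gadget with external
vertices `x, y`, then every FO-2-coloring colors `x` and `y` differently. -/
theorem ne_gadget
    {V : Type*} [Fintype V] [DecidableEq V] (m : V → V → ℕ)
    (hsymm : ∀ u v, m u v = m v u) (hloop : ∀ v, m v v = 0)
    (x y : V) (S : Set V) (hgadget : IsNEGadget m x y S)
    (c : V → Bool) (f : V → V) (hcf : IsFO2Coloring m c f) :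
    c x ≠ c y := by
  obtain ⟨u, v, S₁, S₂, huv, hxu, hyv, hd, -⟩ := hgadget
  have hne : u ≠ v := by simp at hd; tauto
  rw [hcf.eq_of_isEQGadget hxu, hcf.eq_of_isEQGadget hyv]
  exact hcf.ne_of_three_le hne huv.ge
end

section
/- Let (V, m) be a finite multigraph containing an OR-gadget with external vertices x, y, z. Then every FO-2-coloring (c, f) of (V, m) satisfies c z = c x or c z = c y. -/
/-- The multigraph `m` contains an OR-gadget with external vertices `x, y, z`:
there are five distinct vertices `γ, ζ, η, α, β` forming a pentagon of double
edges, EQ-gadgets with external pairs `(ζ, x)`, `(γ, y)`, `(α, z)` whose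
internal vertex sets are pairwise disjoint and disjoint from
`{x, y, z, γ, ζ, η, α, β}`, and each pentagon vertex has `m`-value `0` to
every vertex other than its pentagon neighbors and the vertices of its
respective EQ-gadget (`η` and `β` have only their pentagon double edges). -/
def IsORGadget {V : Type*} (m : V → V → ℕ) (x y z : V) : Prop :=
  ∃ (γ ζ η α β : V) (S₁ S₂ S₃ : Set V),
    List.Pairwise (· ≠ ·) [γ, ζ, η, α, β] ∧
    m γ ζ = 2 ∧ m ζ η = 2 ∧ m η α = 2 ∧ m α β = 2 ∧ m β γ = 2 ∧
    IsEQGadget m ζ x S₁ ∧ IsEQGadget m γ y S₂ ∧ IsEQGadget m α z S₃ ∧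
    Disjoint S₁ S₂ ∧ Disjoint S₁ S₃ ∧ Disjoint S₂ S₃ ∧
    Disjoint (S₁ ∪ S₂ ∪ S₃) ({x, y, z, γ, ζ, η, α, β} : Set V) ∧
    (∀ w, w ∉ ({γ, η, ζ, x} : Set V) → w ∉ S₁ → m ζ w = 0) ∧
    (∀ w, w ∉ ({ζ, β, γ, y} : Set V) → w ∉ S₂ → m γ w = 0) ∧
    (∀ w, w ∉ ({η, β, α, z} : Set V) → w ∉ S₃ → m α w = 0) ∧
    (∀ w, w ∉ ({ζ, α} : Set V) → m η w = 0) ∧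
    (∀ w, w ∉ ({α, γ} : Set V) → m β w = 0)

/-- The endpoints of a monochromatic double edge are each other's images under `f`. -/
lemma IsFO2Coloring.eq_of_two_le {V : Type*} [DecidableEq V] {m : V → V → ℕ} {c : V → Bool}
    {f : V → V} (h : IsFO2Coloring m c f) {u v : V} (hne : u ≠ v) (hm : 2 ≤ m u v)
    (hc : c u = c v) : f u = v ∧ f v = u := by
  have := h.2 u v hne hc
  grind

/-- The endpoints of an edge of multiplicity at least three have different colors. -/
lemma IsFO2Coloring.color_ne_of_three_le {V : Type*} [DecidableEq V] {m : V → V → ℕ}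
    {c : V → Bool} {f : V → V} (h : IsFO2Coloring m c f) {u v : V} (hne : u ≠ v)
    (hm : 3 ≤ m u v) : c u ≠ c v := by
  intro hc
  have := h.2 u v hne hc
  grind

/-- If `s` and `t` are joined by a triple edge, and both are joined to `r` by double edges,
then `f` maps `r` to one of them. -/
lemma IsFO2Coloring.image_mem_of_triangle {V : Type*} [DecidableEq V] {m : V → V → ℕ}
    {c : V → Bool} {f : V → V} (h : IsFO2Coloring m c f) {r s t : V} (hrs : r ≠ s)
    (hrt : r ≠ t) (hst : s ≠ t) (ms : 2 ≤ m r s) (mt : 2 ≤ m r t) (mst : 3 ≤ m s t) :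
    f r = s ∨ f r = t := by
  have hcst := h.color_ne_of_three_le hst mst
  by_cases hs : c r = c s
  · exact .inl (h.eq_of_two_le hrs ms hs).1
  · refine .inr (h.eq_of_two_le hrt mt ?_).1
    revert hs hcst
    cases c r <;> cases c s <;> cases c t <;> simp

/-- The external vertices of an EQ-gadget receive the same color. -/
lemma IsEQGadget.color_eq {V : Type*} [DecidableEq V] {m : V → V → ℕ} {x y : V} {S : Set V}
    (hg : IsEQGadget m x y S) {c : V → Bool} {f : V → V} (h : IsFO2Coloring m c f) :
    c x = c y := by
  obtain ⟨e, ⟨hinj, hm, -⟩, rfl, rfl, -⟩ := hg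
  have ne {i j : Fin 9} (hij : i ≠ j) : e i ≠ e j := hinj.ne hij
  have hα : f (e 3) = e 5 ∨ f (e 3) = e 6 :=
    h.image_mem_of_triangle (ne (by decide)) (ne (by decide)) (ne (by decide))
      (by simp [hm, eqM]) (by simp [hm, eqM]) (by simp [hm, eqM])
  have hβ : f (e 4) = e 7 ∨ f (e 4) = e 8 :=
    h.image_mem_of_triangle (ne (by decide)) (ne (by decide)) (ne (by decide))
      (by simp [hm, eqM]) (by simp [hm, eqM]) (by simp [hm, eqM])
  have hα' (j : Fin 9) (h5 : j ≠ 5) (h6 : j ≠ 6) : f (e 3) ≠ e j := by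
    rcases hα with hα | hα <;> rw [hα] <;> exact ne (Ne.symm ‹_›)
  have hβ' (j : Fin 9) (h7 : j ≠ 7) (h8 : j ≠ 8) : f (e 4) ≠ e j := by
    rcases hβ with hβ | hβ <;> rw [hβ] <;> exact ne (Ne.symm ‹_›)
  have hαβ : c (e 3) ≠ c (e 4) := fun hc => by
    have := h.2 _ _ (ne (by decide)) hc
    rw [if_neg (hα' 4 (by decide) (by decide)), if_neg (hβ' 3 (by decide) (by decide))] at this
    simp [hm, eqM] at this
  have hγ : f (e 2) = e 3 ∨ f (e 2) = e 4 := by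
    by_cases hc : c (e 2) = c (e 3)
    · have := h.2 _ _ (ne (by decide)) hc
      rw [if_neg (hα' 2 (by decide) (by decide))] at this
      by_contra! hcon
      simp [hm, eqM, hcon.1] at this
    · have hc' : c (e 2) = c (e 4) := by
        revert hc hαβ
        cases c (e 2) <;> cases c (e 3) <;> cases c (e 4) <;> simp
      have := h.2 _ _ (ne (by decide)) hc'
      rw [if_neg (hβ' 2 (by decide) (by decide))] at this
      by_contra! hcon
      simp [hm, eqM, hcon.2] at this
  have hγ' (j : Fin 9) (h3 : j ≠ 3) (h4 : j ≠ 4) : f (e 2) ≠ e j := by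
    rcases hγ with hγ | hγ <;> rw [hγ] <;> exact ne (Ne.symm ‹_›)
  have hx : c (e 2) ≠ c (e 0) := fun hc =>
    hγ' 0 (by decide) (by decide) (h.eq_of_two_le (ne (by decide)) (by simp [hm, eqM]) hc).1
  have hy : c (e 2) ≠ c (e 1) := fun hc =>
    hγ' 1 (by decide) (by decide) (h.eq_of_two_le (ne (by decide)) (by simp [hm, eqM]) hc).1
  revert hx hy
  cases c (e 2) <;> cases c (e 0) <;> cases c (e 1) <;> simp

/-- The OR-gadget: if a finite multigraph contains an OR-gadget with external
vertices `x, y, z`, then in every FO-2-coloring the color of `z` equals the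
color of `x` or that of `y`. -/
theorem or_gadget
    {V : Type*} [Fintype V] [DecidableEq V] (m : V → V → ℕ)
    (hsymm : ∀ u v, m u v = m v u) (hloop : ∀ v, m v v = 0)
    (x y z : V) (hgadget : IsORGadget m x y z)
    (c : V → Bool) (f : V → V) (hcf : IsFO2Coloring m c f) :
    c z = c x ∨ c z = c y := by
  obtain ⟨γ, ζ, η, α, β, S₁, S₂, S₃, hne, hγζ, hζη, hηα, hαβ, hβγ, hx, hy, hz, -⟩ := hgadget
  simp only [List.pairwise_cons, List.mem_cons, List.not_mem_nil] at hne
  rw [← hx.color_eq hcf, ← hy.color_eq hcf, ← hz.color_eq hcf]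
  have pγζ := hcf.eq_of_two_le (u := γ) (v := ζ) (by grind) hγζ.ge
  have pζη := hcf.eq_of_two_le (u := ζ) (v := η) (by grind) hζη.ge
  have pηα := hcf.eq_of_two_le (u := η) (v := α) (by grind) hηα.ge
  have pαβ := hcf.eq_of_two_le (u := α) (v := β) (by grind) hαβ.ge
  have pβγ := hcf.eq_of_two_le (u := β) (v := γ) (by grind) hβγ.ge
  cases hcγ : c γ <;> cases hcζ : c ζ <;> cases hcη : c η <;> cases hcα : c α <;>
    cases hcβ : c β <;> grind
end
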